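/- Let (Ω, 𝓕) be a measurable space whose σ-field 𝓕 is not reduced to {∅, Ω}, and let f ∈ 𝔽. Then D_f(P‖Q) = D_f(Q‖P) for all probability measures P, Q on (Ω, 𝓕) if and only if there exist h ∈ 𝔽 and c ∈ ℝ such that f = h + h* + c(Id − 1) on [0, ∞). In that case dom(f) = dom(f*). -/

import Mathlib

open MeasureTheory ProbabilityTheory Filter Set Topology
open scoped ENNReal NNReal

noncomputable section

/-- Extended-real positive part, as a value in `ℝ≥0∞`. -/
def EReal.toENNReal' (x : EReal) : ℝ≥0∞ :=
  if x = ⊤ then ⊤ else ENNReal.ofReal x.toReal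

/-- Quasi-integrability of an extended-real-valued function: the positive part or the negative
part has finite integral. -/
def QuasiIntegrable {Ω : Type*} [MeasurableSpace Ω] (μ : Measure Ω) (g : Ω → EReal) : Prop :=
  (∫⁻ ω, (g ω).toENNReal' ∂μ) < ⊤ ∨ (∫⁻ ω, (-(g ω)).toENNReal' ∂μ) < ⊤

/-- The integral of an extended-real-valued function, defined as the difference of the
integrals of the positive and negative parts. -/
def eInt {Ω : Type*} [MeasurableSpace Ω] (μ : Measure Ω) (g : Ω → EReal) : EReal :=
  ((∫⁻ ω, (g ω).toENNReal' ∂μ : ℝ≥0∞) : EReal) - ((∫⁻ ω, (-(g ω)).toENNReal' ∂μ : ℝ≥0∞) : EReal)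

/-- `f` is strictly convex at the point `z`. -/
def StrictConvexAt (f : ℝ → EReal) (z : ℝ) : Prop :=
  ∀ x y α : ℝ, x ≠ z → y ≠ z → 0 < α → α < 1 → z = α * x + (1 - α) * y →
    f z < (α : EReal) * f x + ((1 - α : ℝ) : EReal) * f y

/-- The class `𝔽` of proper convex functions `f : ℝ → (-∞, +∞]` with domain contained in
`[0, ∞)`, right-continuous at `0`, with `f 1 = 0` and `1` in the interior of the domain. -/
structure MemF (f : ℝ → EReal) : Prop where
  ne_bot : ∀ x, f x ≠ ⊥
  convex : ∀ x y α : ℝ, 0 ≤ α → α ≤ 1 →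
    f (α * x + (1 - α) * y) ≤ (α : EReal) * f x + ((1 - α : ℝ) : EReal) * f y
  top_of_neg : ∀ x : ℝ, x < 0 → f x = ⊤
  right_continuous_at_zero : Tendsto f (nhdsWithin 0 (Set.Ioi 0)) (nhds (f 0))
  one_eq_zero : f 1 = 0
  one_mem_interior_dom : ∃ ε : ℝ, 0 < ε ∧ ∀ x : ℝ, |x - 1| < ε → f x ≠ ⊤

/-- The value `f*(0) = lim_{t → ∞} f(t)/t` of the convex conjugate at `0`. -/
def fStarZero (f : ℝ → EReal) : EReal :=
  Filter.limsup (fun t : ℝ => ((t⁻¹ : ℝ) : EReal) * f t) Filter.atTop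

/-- The convex conjugate `f*` of `f ∈ 𝔽`: `f*(t) = t f(1/t)` for `t > 0`,
`f*(0) = lim_{t→∞} f(t)/t`, and `f* = ⊤` on negative reals. -/
def fConj (f : ℝ → EReal) : ℝ → EReal := fun t =>
  if 0 < t then ((t : ℝ) : EReal) * f t⁻¹
  else if t = 0 then fStarZero f
  else ⊤

/-- The ratio `dP/dQ` defined `(P+Q)`-a.e. via densities w.r.t. `λ = P + Q`, with the
conventions `0/0 = ∞/∞ = 0` (which are those of `ℝ≥0∞` division). -/
def rnRatio {Ω : Type*} [MeasurableSpace Ω] (P Q : Measure Ω) : Ω → ℝ≥0∞ :=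
  fun ω => P.rnDeriv (P + Q) ω / Q.rnDeriv (P + Q) ω

/-- Extension of `f : ℝ → EReal` to `[0, ∞]`, with value `⊤` at `∞`. -/
def extF (f : ℝ → EReal) : ℝ≥0∞ → EReal :=
  fun x => if x = ⊤ then ⊤ else f x.toReal

/-- The `f`-divergence `D_f(P‖Q) = ∫ f(dP/dQ) dQ + f*(0) P(dP/dQ = ∞)`.
Note that `Q(dP/dQ = ∞) = 0`, and that in `EReal` one has `f*(0) · 0 = 0`, which encodes the
convention that the second term vanishes when `P(dP/dQ = ∞) = 0`. -/
def fDiv {Ω : Type*} [MeasurableSpace Ω] (f : ℝ → EReal) (P Q : Measure Ω) : EReal :=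
  eInt Q (fun ω => extF f (rnRatio P Q ω)) +
    fStarZero f * ((P {ω | rnRatio P Q ω = ⊤} : ℝ≥0∞) : EReal)

/-- The Csiszár index `S_f(X,Y) = D_f(P_X ⊗ P_Y ‖ P_{(X,Y)})`. -/
def csiszarIndex {Ω α β : Type*} [MeasurableSpace Ω] [MeasurableSpace α] [MeasurableSpace β]
    (f : ℝ → EReal) (μ : Measure Ω) (X : Ω → α) (Y : Ω → β) : EReal :=
  fDiv f ((μ.map X).prod (μ.map Y)) (μ.map (fun ω => (X ω, Y ω)))


theorem EReal.toENNReal'_eq_toENNReal : EReal.toENNReal' = EReal.toENNReal := rfl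

theorem MemF.measurable {f : ℝ → EReal} (hf : MemF f) : Measurable f := by
  refine measurable_of_Iic fun a => Set.OrdConnected.measurableSet ⟨?_⟩
  intro x hx y hy z hz
  simp only [mem_preimage, mem_Iic] at *
  rcases eq_or_lt_of_le (hz.1.trans hz.2) with h | h
  · have : z = x := le_antisymm (h ▸ hz.2) hz.1
    rwa [this]
  have hyx : 0 < y - x := sub_pos.2 h
  have h1 := hf.convex x y ((y - z) / (y - x)) (div_nonneg (by linarith [hz.2]) hyx.le)
    ((div_le_one hyx).2 (by linarith [hz.1]))
  have h2 : (y - z) / (y - x) * x + (1 - (y - z) / (y - x)) * y = z := by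
    field_simp; ring
  rw [h2] at h1
  refine h1.trans ?_
  have h0 : (0 : ℝ) ≤ (y - z) / (y - x) := div_nonneg (by linarith [hz.2]) hyx.le
  have h0' : (0 : ℝ) ≤ 1 - (y - z) / (y - x) :=
    sub_nonneg.2 ((div_le_one hyx).2 (by linarith [hz.1]))
  generalize (y - z) / (y - x) = α at h0 h0'
  calc (α : EReal) * f x + ((1 - α : ℝ) : EReal) * f y
      ≤ (α : EReal) * a + ((1 - α : ℝ) : EReal) * a :=
        add_le_add (mul_le_mul_of_nonneg_left hx (by exact_mod_cast h0))
          (mul_le_mul_of_nonneg_left hy (by exact_mod_cast h0'))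
    _ = a := by
        rw [← EReal.right_distrib_of_nonneg (by exact_mod_cast h0) (by exact_mod_cast h0'),
          ← EReal.coe_add]
        simp

theorem measurable_rnRatio {Ω : Type*} [MeasurableSpace Ω] (P Q : Measure Ω) :
    Measurable (rnRatio P Q) :=
  (Measure.measurable_rnDeriv _ _).div (Measure.measurable_rnDeriv _ _)

theorem withDensity_rnDeriv_add_left {Ω : Type*} [MeasurableSpace Ω] (P Q : Measure Ω)
    [IsFiniteMeasure P] [IsFiniteMeasure Q] :
    (P + Q).withDensity (P.rnDeriv (P + Q)) = P :=
  Measure.withDensity_rnDeriv_eq _ _ (Measure.AbsolutelyContinuous.rfl.add_right _)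

theorem withDensity_rnDeriv_add_right {Ω : Type*} [MeasurableSpace Ω] (P Q : Measure Ω)
    [IsFiniteMeasure P] [IsFiniteMeasure Q] :
    (P + Q).withDensity (Q.rnDeriv (P + Q)) = Q := by
  rw [add_comm]; exact withDensity_rnDeriv_add_left Q P

/-- The integral of a function of the likelihood ratio, with the singular part weighted by `a`,
as an integral with respect to `P + Q`. -/
theorem lintegral_rnRatio_add {Ω : Type*} [MeasurableSpace Ω] (P Q : Measure Ω)
    [IsFiniteMeasure P] [IsFiniteMeasure Q] {k : ℝ≥0∞ → ℝ≥0∞} (hk : Measurable k) (a : ℝ≥0∞) :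
    ∫⁻ ω, k (rnRatio P Q ω) ∂Q + a * P {ω | rnRatio P Q ω = ⊤} =
      ∫⁻ ω, (Q.rnDeriv (P + Q) ω * k (rnRatio P Q ω) +
        a * {ω | rnRatio P Q ω = ⊤}.indicator (P.rnDeriv (P + Q)) ω) ∂(P + Q) := by
  have hr := measurable_rnRatio P Q
  have hS : MeasurableSet {ω | rnRatio P Q ω = ⊤} := hr (measurableSet_singleton ⊤)
  have hp := Measure.measurable_rnDeriv P (P + Q)
  have hq := Measure.measurable_rnDeriv Q (P + Q)
  rw [lintegral_add_left (f := fun ω => Q.rnDeriv (P + Q) ω * k (rnRatio P Q ω))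
      (hq.mul (hk.comp hr)), lintegral_const_mul _ (hp.indicator hS),
    lintegral_indicator hS, ← withDensity_apply _ hS, withDensity_rnDeriv_add_left]
  congr 1
  have h := lintegral_withDensity_eq_lintegral_mul (P + Q) hq (hk.comp hr)
  rwa [withDensity_rnDeriv_add_right P Q] at h

theorem rnRatio_ne_top_ae {Ω : Type*} [MeasurableSpace Ω] (P Q : Measure Ω)
    [IsFiniteMeasure P] [IsFiniteMeasure Q] : ∀ᵐ ω ∂Q, rnRatio P Q ω ≠ ⊤ := by
  have hQ : Q ≪ P + Q := by
    rw [add_comm]; exact Measure.AbsolutelyContinuous.rfl.add_right _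
  filter_upwards [hQ.ae_le (Measure.rnDeriv_ne_top P (P + Q)), Measure.rnDeriv_pos hQ]
    with ω h1 h2 h3
  rcases ENNReal.div_eq_top.1 h3 with h | h
  · exact h2.ne' h.2
  · exact h1 h.1

theorem lintegral_rnRatio_add_measure_top {Ω : Type*} [MeasurableSpace Ω] (P Q : Measure Ω)
    [IsFiniteMeasure P] [IsFiniteMeasure Q] :
    ∫⁻ ω, rnRatio P Q ω ∂Q + P {ω | rnRatio P Q ω = ⊤} = P univ := by
  have h := lintegral_rnRatio_add P Q measurable_id 1
  simp only [id, one_mul] at h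
  rw [h]
  conv_rhs => rw [← withDensity_rnDeriv_add_left P Q]
  rw [withDensity_apply _ MeasurableSet.univ, setLIntegral_univ]
  refine lintegral_congr_ae ?_
  filter_upwards [Measure.rnDeriv_ne_top P (P + Q), Measure.rnDeriv_ne_top Q (P + Q)] with ω hp hq
  rcases eq_or_ne (Q.rnDeriv (P + Q) ω) 0 with h0 | h0
  · rcases eq_or_ne (P.rnDeriv (P + Q) ω) 0 with h1 | h1
    · simp [rnRatio, h0, h1, indicator]
    · simp [rnRatio, h0, h1, indicator, ENNReal.div_zero]
  · have : rnRatio P Q ω ≠ ⊤ := ENNReal.div_ne_top hp h0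
    simp only [indicator, mem_ofPred_eq, this, if_false, add_zero]
    exact ENNReal.mul_div_cancel h0 hq

/-- Symmetry in the nonnegative case: `k` is invariant under `k ↦ (x ↦ x * k x⁻¹)`. -/
theorem lintegral_rnRatio_add_symm {Ω : Type*} [MeasurableSpace Ω] (P Q : Measure Ω)
    [IsFiniteMeasure P] [IsFiniteMeasure Q] {k : ℝ≥0∞ → ℝ≥0∞} (hk : Measurable k)
    (hsymm : ∀ x, x ≠ 0 → x ≠ ⊤ → k x = x * k x⁻¹) :
    ∫⁻ ω, k (rnRatio P Q ω) ∂Q + k 0 * P {ω | rnRatio P Q ω = ⊤} =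
      ∫⁻ ω, k (rnRatio Q P ω) ∂P + k 0 * Q {ω | rnRatio Q P ω = ⊤} := by
  have aux (p q : ℝ≥0∞) (hp : p ≠ ⊤) (hq : q ≠ ⊤) :
      q * k (p / q) + k 0 * (if p / q = ⊤ then p else 0) =
        p * k (q / p) + k 0 * (if q / p = ⊤ then q else 0) := by
    rcases eq_or_ne q 0 with rfl | h0 <;> rcases eq_or_ne p 0 with rfl | h1
    · simp
    · simp [ENNReal.div_zero h1, mul_comm]
    · simp [ENNReal.div_zero h0, mul_comm]
    · have h2 : p / q ≠ ⊤ := ENNReal.div_ne_top hp h0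
      have h3 : q / p ≠ ⊤ := ENNReal.div_ne_top hq h1
      have h4 : p / q ≠ 0 := (ENNReal.div_pos h1 hq).ne'
      simp only [h2, h3, if_false, mul_zero, add_zero]
      rw [hsymm _ h4 h2, ENNReal.inv_div (Or.inl hq) (Or.inl h0), ← mul_assoc,
        ENNReal.mul_div_cancel h0 hq]
  rw [lintegral_rnRatio_add P Q hk, lintegral_rnRatio_add Q P hk, add_comm Q P]
  refine lintegral_congr_ae ?_
  filter_upwards [Measure.rnDeriv_ne_top P (P + Q), Measure.rnDeriv_ne_top Q (P + Q)] with ω hp hq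
  simp only [indicator, mem_ofPred_eq, rnRatio, add_comm Q P]
  convert aux _ _ hp hq using 3; congr

theorem EReal.toENNReal_add_eq_of_add_eq {x : EReal} {a : ℝ≥0∞} {b : ℝ≥0}
    (h : x + ((b : ℝ≥0∞) : EReal) = a) :
    x.toENNReal + b = (-x).toENNReal + a ∧ (-x).toENNReal ≤ b := by
  rw [EReal.coe_nnreal_eq_coe_real] at h
  induction x with
  | bot => exact absurd h.symm (by simp)
  | top =>
    have : a = ⊤ := by rw [← EReal.coe_ennreal_eq_top_iff, ← h]; simp
    simp [this]
  | coe x =>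
    rw [← EReal.coe_add] at h
    have ha : a ≠ ⊤ := by
      rintro rfl
      exact EReal.coe_ne_top _ h
    lift a to ℝ≥0 using ha
    rw [EReal.coe_nnreal_eq_coe_real, EReal.coe_eq_coe_iff] at h
    have hb := b.coe_nonneg
    have ha := a.coe_nonneg
    rw [← EReal.coe_neg, EReal.real_coe_toENNReal, EReal.real_coe_toENNReal,
      ← ENNReal.ofReal_coe_nnreal (p := b), ← ENNReal.ofReal_coe_nnreal (p := a)]
    refine ⟨?_, ENNReal.ofReal_le_ofReal (by linarith)⟩
    rcases le_total 0 x with hx | hx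
    · rw [ENNReal.ofReal_of_nonpos (by linarith : -x ≤ 0), zero_add,
        ← ENNReal.ofReal_add hx hb, h]
    · rw [ENNReal.ofReal_of_nonpos hx, zero_add,
        ← ENNReal.ofReal_add (by linarith) ha]
      congr 1; linarith

theorem eInt_eq_sub {Ω : Type*} [MeasurableSpace Ω] {μ : Measure Ω} {F : Ω → EReal}
    {a b : Ω → ℝ≥0∞} (ha : Measurable a) (hb : Measurable b)
    (hb' : ∫⁻ ω, b ω ∂μ ≠ ⊤) (h : ∀ᵐ ω ∂μ, F ω + b ω = a ω) :
    eInt μ F = ((∫⁻ ω, a ω ∂μ : ℝ≥0∞) : EReal) - ((∫⁻ ω, b ω ∂μ : ℝ≥0∞) : EReal) := by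
  have h1 : ∀ᵐ ω ∂μ, (F ω).toENNReal + b ω = (-(F ω)).toENNReal + a ω ∧
      (-(F ω)).toENNReal ≤ b ω := by
    filter_upwards [h, ae_lt_top hb hb'] with ω hω hbω
    lift b ω to ℝ≥0 using hbω.ne with b
    exact EReal.toENNReal_add_eq_of_add_eq hω
  have hneg : ∫⁻ ω, (-(F ω)).toENNReal ∂μ ≠ ⊤ :=
    ne_top_of_le_ne_top hb' (lintegral_mono_ae (h1.mono fun ω h => h.2))
  have hsum : ∫⁻ ω, (F ω).toENNReal ∂μ + ∫⁻ ω, b ω ∂μ =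
      ∫⁻ ω, (-(F ω)).toENNReal ∂μ + ∫⁻ ω, a ω ∂μ := by
    rw [← lintegral_add_right _ hb, ← lintegral_add_right _ ha]
    exact lintegral_congr_ae (h1.mono fun ω h => h.1)
  change ((∫⁻ ω, (F ω).toENNReal ∂μ : ℝ≥0∞) : EReal) -
    ((∫⁻ ω, (-(F ω)).toENNReal ∂μ : ℝ≥0∞) : EReal) = _
  generalize (∫⁻ ω, (F ω).toENNReal ∂μ) = A at *
  generalize (∫⁻ ω, (-(F ω)).toENNReal ∂μ) = B at *
  generalize (∫⁻ ω, a ω ∂μ) = C at *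
  generalize (∫⁻ ω, b ω ∂μ) = D at *
  lift B to ℝ≥0 using hneg
  lift D to ℝ≥0 using hb'
  induction A with
  | top =>
    have : C = ⊤ := by simpa using hsum.symm
    subst this
    simp [EReal.coe_nnreal_eq_coe_real]
  | coe A =>
    have hC : C ≠ ⊤ := by
      rintro rfl
      simp [← ENNReal.coe_add] at hsum
    lift C to ℝ≥0 using hC
    have h5 : (A : ℝ) + D = B + C := by exact_mod_cast hsum
    have h6 : (A : ℝ) - B = C - D := by linarith
    simp only [EReal.coe_nnreal_eq_coe_real, ← EReal.coe_sub, h6]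

/-- The `f`-divergence of an affine perturbation `g + c (Id - 1)` of a nonnegative `g` does not
depend on `c`. -/
theorem fDiv_eq_of_eq_add {Ω : Type*} [MeasurableSpace Ω] (P Q : Measure Ω)
    [IsProbabilityMeasure P] [IsProbabilityMeasure Q] {f : ℝ → EReal} {k : ℝ≥0∞ → ℝ≥0∞}
    (hk : Measurable k) (c : ℝ)
    (hfk : ∀ x : ℝ≥0∞, x ≠ ⊤ → f x.toReal = k x + ((c * (x.toReal - 1) : ℝ) : EReal))
    (hstar : fStarZero f = k 0 + (c : EReal)) :
    fDiv f P Q =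
      ((∫⁻ ω, k (rnRatio P Q ω) ∂Q + k 0 * P {ω | rnRatio P Q ω = ⊤} : ℝ≥0∞) : EReal) := by
  have hr := measurable_rnRatio P Q
  have hmass := lintegral_rnRatio_add_measure_top P Q
  rw [measure_univ] at hmass
  have hI : ∫⁻ ω, rnRatio P Q ω ∂Q ≠ ⊤ :=
    ne_top_of_le_ne_top ENNReal.one_ne_top (hmass ▸ le_self_add)
  have hm : P {ω | rnRatio P Q ω = ⊤} ≠ ⊤ := measure_ne_top _ _
  have ha : ∫⁻ ω, k (rnRatio P Q ω) + (ENNReal.ofReal c * rnRatio P Q ω + ENNReal.ofReal (-c)) ∂Q =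
      ∫⁻ ω, k (rnRatio P Q ω) ∂Q +
        (ENNReal.ofReal c * ∫⁻ ω, rnRatio P Q ω ∂Q + ENNReal.ofReal (-c)) := by
    rw [lintegral_add_left (f := fun ω => k (rnRatio P Q ω)) (hk.comp hr),
      lintegral_add_right _ measurable_const,
      lintegral_const_mul _ hr]
    simp
  have hb : ∫⁻ ω, (ENNReal.ofReal (-c) * rnRatio P Q ω + ENNReal.ofReal c) ∂Q =
      ENNReal.ofReal (-c) * ∫⁻ ω, rnRatio P Q ω ∂Q + ENNReal.ofReal c := by
    rw [lintegral_add_right _ measurable_const, lintegral_const_mul _ hr]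
    simp
  have hpm : c = max c 0 - max (-c) 0 := by
    rcases le_total 0 c with h | h <;> simp [h]
  have key : eInt Q (fun ω => extF f (rnRatio P Q ω)) = _ :=
    eInt_eq_sub (a := fun ω => k (rnRatio P Q ω) +
        (ENNReal.ofReal c * rnRatio P Q ω + ENNReal.ofReal (-c)))
      (b := fun ω => ENNReal.ofReal (-c) * rnRatio P Q ω + ENNReal.ofReal c)
      ((hk.comp hr).add ((hr.const_mul _).add_const _)) ((hr.const_mul _).add_const _)
      (by rw [hb]; finiteness) (by
        filter_upwards [rnRatio_ne_top_ae P Q] with ω hω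
        generalize rnRatio P Q ω = x at hω
        simp only [extF, hω, if_false, hfk x hω]
        lift x to ℝ≥0 using hω
        simp only [EReal.coe_ennreal_add, EReal.coe_ennreal_mul, EReal.coe_ennreal_ofReal,
          EReal.coe_nnreal_eq_coe_real, ENNReal.coe_toReal]
        rw [add_assoc]
        congr 1
        norm_cast
        linear_combination (x.toReal - 1) * hpm)
  rw [fDiv, key, ha, hb, hstar, EReal.right_distrib_of_nonneg_of_ne_top
    (EReal.coe_ennreal_nonneg _) (by simp [hm]), ← EReal.coe_ennreal_mul]
  generalize ∫⁻ ω, k (rnRatio P Q ω) ∂Q = K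
  generalize k 0 * P {ω | rnRatio P Q ω = ⊤} = W
  generalize P {ω | rnRatio P Q ω = ⊤} = m at *
  generalize ∫⁻ ω, rnRatio P Q ω ∂Q = I at *
  lift I to ℝ≥0 using hI
  lift m to ℝ≥0 using hm
  have hIm : (I : ℝ) + m = 1 := by exact_mod_cast hmass
  simp only [EReal.coe_ennreal_add, EReal.coe_ennreal_mul, EReal.coe_ennreal_ofReal,
    EReal.coe_nnreal_eq_coe_real]
  generalize max c 0 = u at hpm
  generalize max (-c) 0 = v at hpm
  induction K with
  | top =>
    simp only [← EReal.coe_mul, ← EReal.coe_add, EReal.coe_ennreal_top, EReal.top_add_coe,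
      EReal.top_sub_coe]
    induction W with
    | top =>
      simp only [EReal.coe_ennreal_top, EReal.top_add_coe, EReal.top_add_top]
    | coe W => simp only [EReal.coe_nnreal_eq_coe_real, ← EReal.coe_add, EReal.top_add_coe]
  | coe K =>
    simp only [EReal.coe_nnreal_eq_coe_real, ← EReal.coe_mul, ← EReal.coe_add, ← EReal.coe_sub]
    induction W with
    | top =>
      simp only [EReal.coe_ennreal_top, EReal.top_add_coe, EReal.coe_add_top]
    | coe W =>
      simp only [EReal.coe_nnreal_eq_coe_real, ← EReal.coe_add, EReal.coe_eq_coe_iff]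
      linear_combination (u - v) * hIm + (m:ℝ) * hpm

theorem MemF.le_of_one_lt {f : ℝ → EReal} (hf : MemF f) {s : ℝ} (hs : s < 1) (hfs : f s ≠ ⊤)
    {t : ℝ} (ht : 1 < t) : (((f s).toReal * ((1 - t) / (1 - s)) : ℝ) : EReal) ≤ f t := by
  have h0 : 0 < t - s := by linarith
  have h1s : 0 < 1 - s := by linarith
  have h1 := hf.convex s t ((t - 1) / (t - s)) (div_nonneg (by linarith) h0.le)
    ((div_le_one h0).2 (by linarith))
  rw [show (t - 1) / (t - s) * s + (1 - (t - 1) / (t - s)) * t = 1 by field_simp; ring,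
    hf.one_eq_zero] at h1
  have h2 := hf.ne_bot s
  have h3 := hf.ne_bot t
  generalize f s = u at *
  generalize f t = v at *
  lift u to ℝ using ⟨hfs, h2⟩
  induction v with
  | bot => exact absurd rfl h3
  | top => exact le_top
  | coe v =>
    norm_cast at h1 ⊢
    rw [EReal.toReal_coe]
    have h4 : 0 ≤ (t - s) * ((t - 1) / (t - s) * u + (1 - (t - 1) / (t - s)) * v) :=
      mul_nonneg h0.le h1
    have h5 : (t - s) * ((t - 1) / (t - s) * u + (1 - (t - 1) / (t - s)) * v) =
      (t - 1) * u + (1 - s) * v := by field_simp; ring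
    rw [h5] at h4
    rw [mul_div_assoc', div_le_iff₀ h1s]
    linarith

theorem MemF.exists_lt_one {f : ℝ → EReal} (hf : MemF f) : ∃ s : ℝ, s < 1 ∧ f s ≠ ⊤ := by
  obtain ⟨ε, hε, h⟩ := hf.one_mem_interior_dom
  refine ⟨1 - ε / 2, by linarith, h _ ?_⟩
  rw [abs_lt]; constructor <;> linarith

theorem MemF.fStarZero_ne_bot {f : ℝ → EReal} (hf : MemF f) : fStarZero f ≠ ⊥ := by
  obtain ⟨s, hs, hfs⟩ := hf.exists_lt_one
  have hlim : Tendsto (fun t : ℝ => (((f s).toReal * ((t⁻¹ - 1) / (1 - s)) : ℝ) : EReal)) atTop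
      (𝓝 (((f s).toReal * ((0 - 1) / (1 - s)) : ℝ) : EReal)) :=
    (continuous_coe_real_ereal.tendsto _).comp
      (((tendsto_inv_atTop_zero.sub_const _).div_const _).const_mul _)
  have hle : (((f s).toReal * ((0 - 1) / (1 - s)) : ℝ) : EReal) ≤ fStarZero f := by
    rw [← hlim.limsup_eq]
    refine limsup_le_limsup ?_
    filter_upwards [eventually_gt_atTop 1] with t ht
    have ht0 : 0 < t := by linarith
    calc (((f s).toReal * ((t⁻¹ - 1) / (1 - s)) : ℝ) : EReal)
        = ((t⁻¹ : ℝ) : EReal) * (((f s).toReal * ((1 - t) / (1 - s)) : ℝ) : EReal) := by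
          rw [← EReal.coe_mul]; congr 1; field_simp
      _ ≤ _ := mul_le_mul_of_nonneg_left (hf.le_of_one_lt hs hfs ht)
          (by exact_mod_cast (inv_pos.2 ht0).le)
  exact ((EReal.bot_lt_coe _).trans_le hle).ne'

theorem EReal.coe_mul_ne_bot {a : ℝ} (ha : 0 ≤ a) {x : EReal} (hx : x ≠ ⊥) :
    (a : EReal) * x ≠ ⊥ := by
  induction x with
  | bot => exact absurd rfl hx
  | coe x => exact EReal.coe_ne_bot _
  | top =>
    rcases ha.eq_or_lt with rfl | h
    · simp
    · simp [EReal.coe_mul_top_of_pos h]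

theorem MemF.fConj_ne_bot {f : ℝ → EReal} (hf : MemF f) (t : ℝ) : fConj f t ≠ ⊥ := by
  unfold fConj
  split_ifs with h h'
  · exact EReal.coe_mul_ne_bot h.le (hf.ne_bot _)
  · exact hf.fStarZero_ne_bot
  · simp

theorem fConj_of_pos (f : ℝ → EReal) {t : ℝ} (ht : 0 < t) : fConj f t = (t : EReal) * f t⁻¹ :=
  if_pos ht

theorem fConj_zero (f : ℝ → EReal) : fConj f 0 = fStarZero f := by simp [fConj]

theorem fConj_of_neg (f : ℝ → EReal) {t : ℝ} (ht : t < 0) : fConj f t = ⊤ := by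
  simp [fConj, ht.not_gt, ht.ne]

theorem EReal.coe_mul_add {a : ℝ} (ha : 0 ≤ a) (x y : EReal) :
    (a : EReal) * (x + y) = a * x + a * y :=
  EReal.left_distrib_of_nonneg_of_ne_top (by exact_mod_cast ha) (EReal.coe_ne_top _) x y

theorem EReal.coe_mul_coe_mul (a b : ℝ) (x : EReal) :
    (a : EReal) * (b * x) = ((a * b : ℝ) : EReal) * x := by
  rw [EReal.coe_mul, mul_assoc]

theorem fStarZero_of_eq_add_fConj {f h : ℝ → EReal} (hh : MemF h) {c : ℝ}
    (hfh : ∀ t : ℝ, 0 ≤ t → f t = h t + fConj h t + ((c * (t - 1) : ℝ) : EReal)) :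
    fStarZero f = h 0 + fConj h 0 + (c : EReal) := by
  have hv : Tendsto (fun t : ℝ => h t⁻¹ + ((c * (1 - t⁻¹) : ℝ) : EReal)) atTop
      (𝓝 (h 0 + ((c * (1 - 0) : ℝ) : EReal))) := by
    refine (EReal.continuousAt_add (Or.inr (EReal.coe_ne_bot _))
      (Or.inr (EReal.coe_ne_top _))).tendsto.comp
      (Tendsto.prodMk_nhds ?_ ?_)
    · exact hh.right_continuous_at_zero.comp tendsto_inv_atTop_nhdsGT_zero
    · exact (continuous_coe_real_ereal.tendsto _).comp
        ((tendsto_inv_atTop_zero.const_sub _).const_mul _)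
  have heq : fStarZero f = limsup ((fun t : ℝ => ((t⁻¹ : ℝ) : EReal) * h t) +
      fun t : ℝ => h t⁻¹ + ((c * (1 - t⁻¹) : ℝ) : EReal)) atTop := by
    refine limsup_congr ?_
    filter_upwards [eventually_gt_atTop 0] with t ht
    have ht' := (inv_pos.2 ht).le
    rw [hfh t ht.le, fConj_of_pos _ ht, EReal.coe_mul_add ht', EReal.coe_mul_add ht',
      EReal.coe_mul_coe_mul, inv_mul_cancel₀ ht.ne', EReal.coe_one, one_mul, ← EReal.coe_mul,
      add_assoc, Pi.add_apply, show t⁻¹ * (c * (t - 1)) = c * (1 - t⁻¹) by field_simp]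
  have hbot : limsup (fun t : ℝ => ((t⁻¹ : ℝ) : EReal) * h t) atTop ≠ ⊥ := hh.fStarZero_ne_bot
  have hvbot : h 0 + ((c * (1 - 0) : ℝ) : EReal) ≠ ⊥ := by
    simp [EReal.add_eq_bot_iff, hh.ne_bot 0]
  rw [heq]
  trans fStarZero h + (h 0 + ((c * (1 - 0) : ℝ) : EReal))
  · refine le_antisymm ?_ ?_
    · refine (EReal.limsup_add_le (Or.inl hbot) (Or.inr ?_)).trans_eq ?_
      · rwa [hv.limsup_eq]
      · rw [hv.limsup_eq]; rfl
    · refine Eq.trans_le ?_ EReal.le_limsup_add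
      rw [hv.liminf_eq]; rfl
  · rw [fConj_zero, sub_zero, mul_one, ← add_assoc, add_comm (fStarZero h)]

theorem add_fConj_symm {h : ℝ → EReal} {t : ℝ} (ht : 0 < t) :
    h t + fConj h t = (t : EReal) * (h t⁻¹ + fConj h t⁻¹) := by
  rw [fConj_of_pos _ ht, fConj_of_pos _ (inv_pos.2 ht), EReal.coe_mul_add ht.le,
    EReal.coe_mul_coe_mul, mul_inv_cancel₀ ht.ne', inv_inv, EReal.coe_one, one_mul, add_comm]

theorem MemF.add_fConj_nonneg_of_pos {h : ℝ → EReal} (hh : MemF h) {t : ℝ} (ht : 0 < t) :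
    0 ≤ h t + fConj h t := by
  have h1 := hh.convex t t⁻¹ (1 / (1 + t)) (by positivity)
    ((div_le_one (by positivity)).2 (by linarith))
  rw [show 1 / (1 + t) * t + (1 - 1 / (1 + t)) * t⁻¹ = 1 by field_simp; ring,
    hh.one_eq_zero] at h1
  have h2 := mul_nonneg (a := ((1 + t : ℝ) : EReal)) (by exact_mod_cast (by positivity)) h1
  rw [EReal.coe_mul_add (by positivity), EReal.coe_mul_coe_mul, EReal.coe_mul_coe_mul,
    show (1 + t) * (1 / (1 + t)) = 1 by field_simp,
    show (1 + t) * (1 - 1 / (1 + t)) = t by field_simp; ring, EReal.coe_one, one_mul] at h2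
  rwa [fConj_of_pos _ ht]

theorem MemF.add_fConj_nonneg {f h : ℝ → EReal} (hf : MemF f) (hh : MemF h) {c : ℝ}
    (hfh : ∀ t : ℝ, 0 ≤ t → f t = h t + fConj h t + ((c * (t - 1) : ℝ) : EReal))
    {t : ℝ} (ht : 0 ≤ t) : 0 ≤ h t + fConj h t := by
  rcases ht.eq_or_lt with rfl | ht
  · have hlim : Tendsto (fun t : ℝ => ((c * (t - 1) : ℝ) : EReal)) (𝓝[>] 0)
        (𝓝 ((c * (0 - 1) : ℝ) : EReal)) :=
      ((continuous_coe_real_ereal.comp (by fun_prop : Continuous fun t : ℝ => c * (t - 1))).tendsto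
        0).mono_left nhdsWithin_le_nhds
    have hle : ((c * (0 - 1) : ℝ) : EReal) ≤ f 0 := by
      refine le_of_tendsto_of_tendsto hlim hf.right_continuous_at_zero ?_
      filter_upwards [self_mem_nhdsWithin] with t ht
      rw [hfh t (le_of_lt ht)]
      exact le_add_of_nonneg_left (hh.add_fConj_nonneg_of_pos ht)
    rw [hfh 0 le_rfl] at hle
    generalize h 0 + fConj h 0 = x at hle
    induction x with
    | bot => simp at hle
    | top => simp
    | coe x => norm_cast at hle ⊢; linarith
  · exact hh.add_fConj_nonneg_of_pos ht

theorem MemF.fDiv_symm {f h : ℝ → EReal} (hf : MemF f) (hh : MemF h) {c : ℝ}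
    (hfh : ∀ t : ℝ, 0 ≤ t → f t = h t + fConj h t + ((c * (t - 1) : ℝ) : EReal))
    {Ω : Type*} [MeasurableSpace Ω] (P Q : Measure Ω)
    [IsProbabilityMeasure P] [IsProbabilityMeasure Q] : fDiv f P Q = fDiv f Q P := by
  set k : ℝ≥0∞ → ℝ≥0∞ := fun x => (h x.toReal + fConj h x.toReal).toENNReal with hkdef
  have hk_coe (x : ℝ≥0∞) : (k x : EReal) = h x.toReal + fConj h x.toReal :=
    EReal.coe_toENNReal (hf.add_fConj_nonneg hh hfh ENNReal.toReal_nonneg)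
  have hk : Measurable k := by
    have : k = fun x => (f x.toReal + ((-(c * (x.toReal - 1)) : ℝ) : EReal)).toENNReal := by
      funext x
      rw [hkdef, hfh _ ENNReal.toReal_nonneg, add_assoc, ← EReal.coe_add, add_neg_cancel,
        EReal.coe_zero, add_zero]
    rw [this]
    refine ((hf.measurable.comp ENNReal.measurable_toReal).add ?_).ereal_toENNReal
    exact measurable_coe_real_ereal.comp
      ((measurable_const.mul (ENNReal.measurable_toReal.sub measurable_const)).neg)
  have hfk (x : ℝ≥0∞) (_ : x ≠ ⊤) :
      f x.toReal = k x + ((c * (x.toReal - 1) : ℝ) : EReal) := by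
    rw [hk_coe, hfh _ ENNReal.toReal_nonneg]
  have hstar : fStarZero f = k 0 + (c : EReal) := by
    rw [hk_coe, ENNReal.toReal_zero, fStarZero_of_eq_add_fConj hh hfh]
  rw [fDiv_eq_of_eq_add P Q hk c hfk hstar, fDiv_eq_of_eq_add Q P hk c hfk hstar,
    lintegral_rnRatio_add_symm P Q hk]
  intro x h0 htop
  have hx : 0 < x.toReal := ENNReal.toReal_pos h0 htop
  simp only [hkdef, ENNReal.toReal_inv]
  rw [add_fConj_symm hx, EReal.toENNReal_mul (by exact_mod_cast hx.le),
    EReal.real_coe_toENNReal, ENNReal.ofReal_toReal htop]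

theorem ENNReal.coe_mul_add_sub_toENNReal {u v : EReal} (hu : u ≠ ⊥) (hv : v ≠ ⊥) (a b : ℝ≥0) :
    (((a : ℝ≥0∞) * u.toENNReal + b * v.toENNReal : ℝ≥0∞) : EReal) -
      (((a : ℝ≥0∞) * (-u).toENNReal + b * (-v).toENNReal : ℝ≥0∞) : EReal) =
      ((a : ℝ) : EReal) * u + ((b : ℝ) : EReal) * v := by
  have key {u : EReal} (hu : u ≠ ⊥) (a : ℝ≥0) : ∃ x : ℝ≥0∞, ∃ y : ℝ≥0,
      (a : ℝ≥0∞) * u.toENNReal = x ∧ (a : ℝ≥0∞) * (-u).toENNReal = y ∧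
        ((a : ℝ) : EReal) * u = x - ((y : ℝ) : EReal) := by
    induction u with
    | bot => exact absurd rfl hu
    | top =>
      refine ⟨a * ⊤, 0, by simp, by simp, ?_⟩
      simp [EReal.coe_ennreal_mul, EReal.coe_nnreal_eq_coe_real]
    | coe u =>
      refine ⟨(a * u.toNNReal : ℝ≥0), a * (-u).toNNReal, ?_, ?_, ?_⟩
      · rw [EReal.real_coe_toENNReal, ENNReal.coe_mul]; rfl
      · rw [← EReal.coe_neg, EReal.real_coe_toENNReal, ENNReal.coe_mul]; rfl
      · rw [EReal.coe_nnreal_eq_coe_real, ← EReal.coe_mul, ← EReal.coe_sub, EReal.coe_eq_coe_iff]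
        simp only [NNReal.coe_mul, Real.coe_toNNReal']
        rcases le_total 0 u with h | h <;> simp [h]
  obtain ⟨x, y, h1, h2, h3⟩ := key hu a
  obtain ⟨x', y', h1', h2', h3'⟩ := key hv b
  rw [h1, h2, h3, h1', h2', h3', ← ENNReal.coe_add, EReal.coe_nnreal_eq_coe_real,
    EReal.coe_ennreal_add]
  induction x with
  | top =>
    induction x' with
    | top => simp only [EReal.coe_ennreal_top, EReal.top_sub_coe, EReal.top_add_top]
    | coe x' => simp only [EReal.coe_ennreal_top, EReal.coe_nnreal_eq_coe_real, EReal.top_sub_coe,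
        EReal.top_add_coe, ← EReal.coe_sub]
  | coe x =>
    induction x' with
    | top => simp only [EReal.coe_ennreal_top, EReal.coe_nnreal_eq_coe_real, EReal.top_sub_coe,
        EReal.coe_add_top, ← EReal.coe_sub]
    | coe x' =>
      simp only [EReal.coe_nnreal_eq_coe_real, ← EReal.coe_sub, ← EReal.coe_add]
      congr 1
      push_cast
      ring

/-- The measure giving mass `a` to `x` and mass `b` to `y`. -/
def twoPoint {Ω : Type*} [MeasurableSpace Ω] (x y : Ω) (a b : ℝ≥0) : Measure Ω :=
  (a : ℝ≥0∞) • Measure.dirac x + (b : ℝ≥0∞) • Measure.dirac y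

theorem twoPoint_comm {Ω : Type*} [MeasurableSpace Ω] (x y : Ω) (a b : ℝ≥0) :
    twoPoint x y a b = twoPoint y x b a := add_comm _ _

theorem lintegral_twoPoint {Ω : Type*} [MeasurableSpace Ω] (x y : Ω) (a b : ℝ≥0)
    {φ : Ω → ℝ≥0∞} (hφ : Measurable φ) :
    ∫⁻ ω, φ ω ∂(twoPoint x y a b) = a * φ x + b * φ y := by
  rw [twoPoint, lintegral_add_measure, lintegral_smul_measure, lintegral_smul_measure,
    lintegral_dirac' _ hφ, lintegral_dirac' _ hφ, smul_eq_mul, smul_eq_mul]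

instance {Ω : Type*} [MeasurableSpace Ω] (x y : Ω) (a b : ℝ≥0) :
    IsFiniteMeasure (twoPoint x y a b) :=
  ⟨by rw [← setLIntegral_one, Measure.restrict_univ, lintegral_twoPoint x y a b measurable_const]
      finiteness⟩

theorem isProbabilityMeasure_twoPoint {Ω : Type*} [MeasurableSpace Ω] (x y : Ω) {a b : ℝ≥0}
    (h : a + b = 1) : IsProbabilityMeasure (twoPoint x y a b) :=
  ⟨by rw [← setLIntegral_one, Measure.restrict_univ, lintegral_twoPoint x y a b measurable_const]
      simp [← ENNReal.coe_add, h]⟩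

theorem rnRatio_twoPoint_left {Ω : Type*} [MeasurableSpace Ω] {A : Set Ω} (hA : MeasurableSet A)
    {x y : Ω} (hx : x ∈ A) (hy : y ∉ A) {p p' q q' : ℝ≥0} (hpq : p + q ≠ 0) :
    rnRatio (twoPoint x y p p') (twoPoint x y q q') x = (p : ℝ≥0∞) / q := by
  have hsum : twoPoint x y p p' + twoPoint x y q q' = twoPoint x y (p + q) (p' + q') := by
    simp only [twoPoint, ENNReal.coe_add, add_smul]
    abel
  have hmeas (a b : ℝ≥0) : twoPoint x y a b A = a := by
    rw [← lintegral_indicator_one hA,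
      lintegral_twoPoint x y a b (measurable_one.indicator hA)]
    simp [hx, hy]
  have hdens {a b : ℝ≥0} {φ : Ω → ℝ≥0∞} (hφ : Measurable φ)
      (h : (twoPoint x y p p' + twoPoint x y q q').withDensity φ = twoPoint x y a b) :
      (a : ℝ≥0∞) = ((p + q : ℝ≥0) : ℝ≥0∞) * φ x := by
    rw [← hmeas a b, ← h, withDensity_apply _ hA, ← lintegral_indicator hA, hsum,
      lintegral_twoPoint _ _ _ _ (hφ.indicator hA)]
    simp [hx, hy]
  have hp := hdens (Measure.measurable_rnDeriv _ _)
    (withDensity_rnDeriv_add_left (twoPoint x y p p') (twoPoint x y q q'))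
  have hq := hdens (Measure.measurable_rnDeriv _ _)
    (withDensity_rnDeriv_add_right (twoPoint x y p p') (twoPoint x y q q'))
  rw [hp, hq, ENNReal.mul_div_mul_left _ _ (by exact_mod_cast hpq) ENNReal.coe_ne_top, rnRatio]

theorem rnRatio_twoPoint_right {Ω : Type*} [MeasurableSpace Ω] {A : Set Ω} (hA : MeasurableSet A)
    {x y : Ω} (hx : x ∈ A) (hy : y ∉ A) {p p' q q' : ℝ≥0} (hpq : p' + q' ≠ 0) :
    rnRatio (twoPoint x y p p') (twoPoint x y q q') y = (p' : ℝ≥0∞) / q' := by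
  rw [twoPoint_comm x y, twoPoint_comm x y]
  exact rnRatio_twoPoint_left hA.compl hy (not_not.2 hx) hpq

theorem extF_ne_bot {f : ℝ → EReal} (hf : MemF f) (x : ℝ≥0∞) : extF f x ≠ ⊥ := by
  unfold extF; split_ifs
  · simp
  · exact hf.ne_bot _

theorem measurable_extF {f : ℝ → EReal} (hf : MemF f) : Measurable (extF f) :=
  Measurable.ite (measurableSet_singleton ⊤) measurable_const
    (hf.measurable.comp ENNReal.measurable_toReal)

theorem fDiv_twoPoint {f : ℝ → EReal} (hf : MemF f) {Ω : Type*} [MeasurableSpace Ω] {A : Set Ω}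
    (hA : MeasurableSet A) {x y : Ω} (hx : x ∈ A) (hy : y ∉ A) {p p' q q' : ℝ≥0}
    (hpq : p + q ≠ 0) (hpq' : p' + q' ≠ 0) :
    fDiv f (twoPoint x y p p') (twoPoint x y q q') =
      ((q : ℝ) : EReal) * extF f (p / q) + ((q' : ℝ) : EReal) * extF f (p' / q') +
        fStarZero f * ((p * ({⊤} : Set ℝ≥0∞).indicator 1 ((p : ℝ≥0∞) / q) +
          p' * ({⊤} : Set ℝ≥0∞).indicator 1 ((p' : ℝ≥0∞) / q') : ℝ≥0∞) : EReal) := by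
  have hr := measurable_rnRatio (twoPoint x y p p') (twoPoint x y q q')
  have hg := (measurable_extF hf).comp hr
  have hx' := rnRatio_twoPoint_left hA hx hy (p' := p') (q' := q') hpq
  have hy' := rnRatio_twoPoint_right hA hx hy (p := p) (q := q) hpq'
  have hpos := lintegral_twoPoint x y q q' hg.ereal_toENNReal
  have hneg := lintegral_twoPoint x y q q' hg.neg.ereal_toENNReal
  simp only [Function.comp, Pi.neg_apply, hx', hy'] at hpos hneg
  have hI : eInt (twoPoint x y q q')
      (fun ω => extF f (rnRatio (twoPoint x y p p') (twoPoint x y q q') ω)) =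
      ((q : ℝ) : EReal) * extF f (p / q) + ((q' : ℝ) : EReal) * extF f (p' / q') := by
    rw [eInt, EReal.toENNReal'_eq_toENNReal, hpos, hneg]
    exact ENNReal.coe_mul_add_sub_toENNReal (extF_ne_bot hf _) (extF_ne_bot hf _) q q'
  have hS : MeasurableSet {ω | rnRatio (twoPoint x y p p') (twoPoint x y q q') ω = ⊤} :=
    hr (measurableSet_singleton ⊤)
  rw [fDiv, hI, ← lintegral_indicator_one hS,
    lintegral_twoPoint _ _ _ _ (measurable_one.indicator hS)]
  simp only [indicator, mem_ofPred_eq, hx', hy', mem_singleton_iff, Pi.one_apply]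

/-- Symmetry of the divergence on the two-point measures with likelihood ratios `s < 1 < t`. -/
theorem MemF.two_point_identity {f : ℝ → EReal} (hf : MemF f) {Ω : Type*} [MeasurableSpace Ω]
    (hΩ : ∃ A : Set Ω, MeasurableSet A ∧ A.Nonempty ∧ A ≠ Set.univ)
    (hsymm : ∀ P Q : Measure Ω, IsProbabilityMeasure P → IsProbabilityMeasure Q →
        fDiv f P Q = fDiv f Q P) {s t : ℝ} (hs : 0 ≤ s) (hs1 : s < 1) (ht : 1 < t) :
    ((t - 1 : ℝ) : EReal) * f s + ((1 - s : ℝ) : EReal) * f t =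
      ((t - 1 : ℝ) : EReal) * fConj f s + ((1 - s : ℝ) : EReal) * fConj f t := by
  obtain ⟨A, hA, ⟨x, hx⟩, hAu⟩ := hΩ
  obtain ⟨y, hy⟩ := (ne_univ_iff_exists_notMem A).1 hAu
  have ht0 : 0 < t := by linarith
  have hts : 0 < t - s := by linarith
  lift s to ℝ≥0 using hs
  lift t to ℝ≥0 using ht0.le
  obtain ⟨q, hq⟩ : ∃ q : ℝ≥0, (q : ℝ) = (t - 1) / (t - s) :=
    ⟨⟨_, (div_pos (by linarith) hts).le⟩, rfl⟩
  obtain ⟨q', hq'⟩ : ∃ q' : ℝ≥0, (q' : ℝ) = (1 - s) / (t - s) :=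
    ⟨⟨_, (div_pos (by linarith) hts).le⟩, rfl⟩
  have hqpos : 0 < q := by rw [← NNReal.coe_pos, hq]; exact div_pos (by linarith) hts
  have hq'pos : 0 < q' := by rw [← NNReal.coe_pos, hq']; exact div_pos (by linarith) hts
  have ht0' : t ≠ 0 := by exact_mod_cast ht0.ne'
  have hsumQ : q + q' = 1 := by
    rw [← NNReal.coe_inj]; push_cast; rw [hq, hq']; field_simp; ring
  have hsumP : q * s + q' * t = 1 := by
    rw [← NNReal.coe_inj]; push_cast; rw [hq, hq']; field_simp; ring
  have h := hsymm (twoPoint x y (q * s) (q' * t)) (twoPoint x y q q')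
    (isProbabilityMeasure_twoPoint x y hsumP) (isProbabilityMeasure_twoPoint x y hsumQ)
  have hne : q * s + q ≠ 0 := (by positivity : 0 < q * s + q).ne'
  have hne' : q' * t + q' ≠ 0 := (by positivity : 0 < q' * t + q').ne'
  rw [fDiv_twoPoint hf hA hx hy hne hne', fDiv_twoPoint hf hA hx hy (add_comm _ q ▸ hne)
    (add_comm _ q' ▸ hne')] at h
  have hqe : (q : ℝ≥0∞) ≠ 0 := by exact_mod_cast hqpos.ne'
  have hqe' : (q' : ℝ≥0∞) ≠ 0 := by exact_mod_cast hq'pos.ne'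
  have d1 : ((q * s : ℝ≥0) : ℝ≥0∞) / q = s := by
    rw [← ENNReal.coe_div hqpos.ne', mul_div_cancel_left₀ _ hqpos.ne']
  have d2 : ((q' * t : ℝ≥0) : ℝ≥0∞) / q' = t := by
    rw [← ENNReal.coe_div hq'pos.ne', mul_div_cancel_left₀ _ hq'pos.ne']
  have d3 : (q' : ℝ≥0∞) / ((q' * t : ℝ≥0) : ℝ≥0∞) = (t⁻¹ : ℝ≥0) := by
    rw [← ENNReal.coe_div (mul_pos hq'pos (by exact_mod_cast ht0)).ne']
    congr 1; field_simp
  rw [d1, d2, d3] at h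
  have e1 : extF f (s : ℝ≥0∞) = f s := by simp [extF]
  have e2 : extF f (t : ℝ≥0∞) = f t := by simp [extF]
  have e3 : extF f ((t⁻¹ : ℝ≥0) : ℝ≥0∞) = f (t : ℝ)⁻¹ := by
    simp only [extF, ENNReal.coe_ne_top, if_false, ENNReal.coe_toReal, NNReal.coe_inv]
  have hright : ((q : ℝ) : EReal) * f s + ((q' : ℝ) : EReal) * f t =
      ((q : ℝ) : EReal) * fConj f s + ((q' : ℝ) : EReal) * fConj f t := by
    rw [fConj_of_pos f ht0, EReal.coe_mul_coe_mul]
    rcases eq_or_ne s 0 with rfl | hs0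
    · simp only [mul_zero, ENNReal.coe_zero, ENNReal.div_zero hqe, e2, e3, NNReal.coe_zero] at h ⊢
      simpa [extF, fConj_zero, EReal.coe_nnreal_eq_coe_real, add_comm, mul_comm] using h
    · have d4 : (q : ℝ≥0∞) / ((q * s : ℝ≥0) : ℝ≥0∞) = (s⁻¹ : ℝ≥0) := by
        rw [← ENNReal.coe_div (mul_ne_zero hqpos.ne' hs0)]
        congr 1; field_simp
      have e4 : extF f ((s⁻¹ : ℝ≥0) : ℝ≥0∞) = f (s : ℝ)⁻¹ := by
        simp only [extF, ENNReal.coe_ne_top, if_false, ENNReal.coe_toReal, NNReal.coe_inv]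
      rw [d4, e1, e2, e3, e4] at h
      rw [fConj_of_pos f (by positivity), EReal.coe_mul_coe_mul]
      simpa using h
  have h2 := congrArg (fun z => ((t - s : ℝ) : EReal) * z) hright
  simp only [EReal.coe_mul_add hts.le, EReal.coe_mul_coe_mul] at h2
  rwa [hq, hq', mul_div_cancel₀ _ hts.ne', mul_div_cancel₀ _ hts.ne'] at h2

theorem EReal.eq_add_of_coe_mul_add_eq {w v v' : ℝ} (hw : 0 < w) {x y : EReal} (hx : x ≠ ⊥)
    (hy : y ≠ ⊥) (h : (w : EReal) * x + v = w * y + v') :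
    x = y + (((v' - v) / w : ℝ) : EReal) := by
  induction x with
  | bot => exact absurd rfl hx
  | top =>
    rw [EReal.coe_mul_top_of_pos hw, EReal.top_add_coe] at h
    induction y with
    | bot => exact absurd rfl hy
    | top => rw [EReal.top_add_coe]
    | coe y =>
      exact absurd h.symm (by rw [← EReal.coe_mul, ← EReal.coe_add]; exact EReal.coe_ne_top _)
  | coe x =>
    induction y with
    | bot => exact absurd rfl hy
    | top =>
      rw [EReal.coe_mul_top_of_pos hw, EReal.top_add_coe] at h
      exact absurd h (by rw [← EReal.coe_mul, ← EReal.coe_add]; exact EReal.coe_ne_top _)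
    | coe y =>
      norm_cast at h ⊢
      field_simp
      linarith

theorem MemF.exists_eq_fConj_add {f : ℝ → EReal} (hf : MemF f) {Ω : Type*} [MeasurableSpace Ω]
    (hΩ : ∃ A : Set Ω, MeasurableSet A ∧ A.Nonempty ∧ A ≠ Set.univ)
    (hsymm : ∀ P Q : Measure Ω, IsProbabilityMeasure P → IsProbabilityMeasure Q →
        fDiv f P Q = fDiv f Q P) :
    ∃ c : ℝ, ∀ t : ℝ, 0 ≤ t → f t = fConj f t + ((c * (t - 1) : ℝ) : EReal) := by
  obtain ⟨ε, hε, hfin⟩ := hf.one_mem_interior_dom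
  obtain ⟨t₀, ht₀⟩ : ∃ t₀ : ℝ, t₀ = 1 + ε / 2 := ⟨_, rfl⟩
  have h1t₀ : 1 < t₀ := by linarith
  have ht₀pos : 0 < t₀ := by linarith
  have hs₀pos : 0 < t₀⁻¹ := inv_pos.2 ht₀pos
  have hs₀lt : t₀⁻¹ < 1 := inv_lt_one_of_one_lt₀ h1t₀
  obtain ⟨a, ha⟩ : ∃ a : ℝ, f t₀ = a :=
    ⟨_, (EReal.coe_toReal (hfin _ (by rw [abs_lt]; constructor <;> linarith)) (hf.ne_bot _)).symm⟩
  obtain ⟨b, hb⟩ : ∃ b : ℝ, f t₀⁻¹ = b := by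
    refine ⟨_, (EReal.coe_toReal (hfin _ ?_) (hf.ne_bot _)).symm⟩
    have h1 : 1 - t₀⁻¹ ≤ t₀ - 1 := by
      have : t₀ * (t₀ - 1 - (1 - t₀⁻¹)) = (t₀ - 1) ^ 2 := by field_simp
      nlinarith [sq_nonneg (t₀ - 1)]
    rw [abs_lt]; constructor <;> linarith
  have ha' : fConj f t₀ = ((t₀ * b : ℝ) : EReal) := by rw [fConj_of_pos f ht₀pos, hb, EReal.coe_mul]
  have hb' : fConj f t₀⁻¹ = ((t₀⁻¹ * a : ℝ) : EReal) := by
    rw [fConj_of_pos f hs₀pos, inv_inv, ha, EReal.coe_mul]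
  refine ⟨(a - t₀ * b) / (t₀ - 1), fun t ht => ?_⟩
  rcases lt_trichotomy t 1 with h | rfl | h
  · have key := hf.two_point_identity hΩ hsymm ht h h1t₀
    rw [ha, ha', ← EReal.coe_mul, ← EReal.coe_mul] at key
    rw [EReal.eq_add_of_coe_mul_add_eq (sub_pos.2 h1t₀) (hf.ne_bot _) (hf.fConj_ne_bot _) key]
    congr 2
    ring
  · simp [fConj_of_pos f one_pos, hf.one_eq_zero]
  · have key := hf.two_point_identity hΩ hsymm hs₀pos.le hs₀lt h
    rw [hb, hb', ← EReal.coe_mul, ← EReal.coe_mul, add_comm,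
      add_comm _ ((1 - t₀⁻¹ : ℝ) * _ : EReal)] at key
    rw [EReal.eq_add_of_coe_mul_add_eq (sub_pos.2 hs₀lt) (hf.ne_bot _) (hf.fConj_ne_bot _) key]
    congr 2
    have h1 : t₀ - 1 ≠ 0 := by linarith
    have h2 : 1 - t₀⁻¹ = (t₀ - 1) / t₀ := by field_simp
    rw [h2]
    field_simp

theorem MemF.const_mul {f : ℝ → EReal} (hf : MemF f) {a : ℝ} (ha : 0 < a) :
    MemF fun t => (a : EReal) * f t where
  ne_bot x := EReal.coe_mul_ne_bot ha.le (hf.ne_bot x)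
  convex x y α h0 h1 := by
    refine (mul_le_mul_of_nonneg_left (hf.convex x y α h0 h1) (by exact_mod_cast ha.le)).trans_eq ?_
    rw [EReal.coe_mul_add ha.le, EReal.coe_mul_coe_mul, EReal.coe_mul_coe_mul,
      EReal.coe_mul_coe_mul, EReal.coe_mul_coe_mul, mul_comm a, mul_comm a]
  top_of_neg x hx := by rw [hf.top_of_neg x hx, EReal.coe_mul_top_of_pos ha]
  right_continuous_at_zero :=
    EReal.Tendsto.const_mul hf.right_continuous_at_zero (Or.inl (EReal.coe_ne_bot _))
      (Or.inl (EReal.coe_ne_top _))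
  one_eq_zero := by rw [hf.one_eq_zero, mul_zero]
  one_mem_interior_dom := by
    obtain ⟨ε, hε, h⟩ := hf.one_mem_interior_dom
    refine ⟨ε, hε, fun x hx => ?_⟩
    lift f x to ℝ using ⟨h x hx, hf.ne_bot x⟩ with y
    rw [← EReal.coe_mul]
    exact EReal.coe_ne_top _

theorem fConj_const_mul {f : ℝ → EReal} {a : ℝ} (ha : 0 ≤ a) {t : ℝ} (ht : 0 ≤ t) :
    fConj (fun t => (a : EReal) * f t) t = a * fConj f t := by
  rcases ht.eq_or_lt with rfl | ht
  · rw [fConj_zero, fConj_zero, fStarZero, fStarZero,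
      ← EReal.limsup_const_mul_of_nonneg_of_ne_top (by exact_mod_cast ha) (EReal.coe_ne_top _)]
    simp only [mul_left_comm]
  · rw [fConj_of_pos _ ht, fConj_of_pos _ ht, mul_left_comm]

/-- **Symmetry characterization of the `f`-divergence.** On a measurable space whose σ-field is
not trivial, `D_f(P‖Q) = D_f(Q‖P)` for all probability measures `P, Q` if and only if there
exist `h ∈ 𝔽` and `c ∈ ℝ` with `f = h + h* + c(Id − 1)` on `[0, ∞)`; in that case
`dom f = dom f*`. -/
theorem fDiv_symmetric_iff
    {Ω : Type*} [MeasurableSpace Ω]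
    (hΩ : ∃ A : Set Ω, MeasurableSet A ∧ A.Nonempty ∧ A ≠ Set.univ)
    (f : ℝ → EReal) (hf : MemF f) :
    ((∀ P Q : Measure Ω, IsProbabilityMeasure P → IsProbabilityMeasure Q →
        fDiv f P Q = fDiv f Q P) ↔
      (∃ (h : ℝ → EReal) (c : ℝ), MemF h ∧
        ∀ t : ℝ, 0 ≤ t → f t = h t + fConj h t + ((c * (t - 1) : ℝ) : EReal))) ∧
    ((∀ P Q : Measure Ω, IsProbabilityMeasure P → IsProbabilityMeasure Q →
        fDiv f P Q = fDiv f Q P) →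
      {t : ℝ | f t ≠ ⊤} = {t : ℝ | fConj f t ≠ ⊤}) := by
  have hconj (hsymm : ∀ P Q : Measure Ω, IsProbabilityMeasure P → IsProbabilityMeasure Q →
      fDiv f P Q = fDiv f Q P) := hf.exists_eq_fConj_add hΩ hsymm
  refine ⟨⟨fun hsymm => ?_, ?_⟩, fun hsymm => ?_⟩
  · obtain ⟨c, hc⟩ := hconj hsymm
    refine ⟨fun t => ((1 / 2 : ℝ) : EReal) * f t, c / 2, hf.const_mul (by norm_num), fun t ht => ?_⟩
    beta_reduce
    rw [fConj_const_mul (by norm_num) ht, hc t ht]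
    have hbot := hf.fConj_ne_bot t
    generalize fConj f t = x at hbot
    induction x with
    | bot => exact absurd rfl hbot
    | top =>
      rw [EReal.top_add_coe, EReal.coe_mul_top_of_pos (by norm_num), EReal.top_add_top,
        EReal.top_add_coe]
    | coe x =>
      simp only [← EReal.coe_mul, ← EReal.coe_add]
      congr 1
      ring
  · rintro ⟨h, c, hh, hfh⟩ P Q hP hQ
    exact hf.fDiv_symm hh hfh P Q
  · obtain ⟨c, hc⟩ := hconj hsymm
    ext t
    simp only [mem_ofPred_eq, ne_eq, not_iff_not]
    rcases lt_or_ge t 0 with ht | ht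
    · simp [hf.top_of_neg t ht, fConj_of_neg f ht]
    · rw [hc t ht]
      generalize fConj f t = x
      induction x <;> simp [← EReal.coe_add, -EReal.coe_mul, -EReal.coe_sub]
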